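/- For arbitrary α > 0, lim_{A↓0} C_H(A, αA)/A² = (1/2)·max_{P_X} tr(Cov(HX)), where the maximization is over all distributions P_X on [0,1]^nt (componentwise P(X_k ∈ [0,1]) = 1) satisfying E[‖X‖₁] ≤ α. -/

import Mathlib

open MeasureTheory ProbabilityTheory Matrix Filter Topology
open scoped ENNReal NNReal BigOperators

noncomputable section

namespace MimoOptical

variable {nt nr : ℕ}

/-- The law of a standard Gaussian vector `Z ~ N(0, I_n)` on `ℝ^n`. -/
def stdGaussian (n : ℕ) : Measure (Fin n → ℝ) :=
  Measure.pi fun _ => gaussianReal 0 1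

/-- Real-valued Kullback–Leibler divergence `∫ log (dμ/dν) dμ`
(with junk value if not absolutely continuous or not integrable). -/
def klDivR {Ω : Type*} [MeasurableSpace Ω] (μ ν : Measure Ω) : ℝ :=
  ∫ ω, Real.log (μ.rnDeriv ν ω).toReal ∂μ

/-- Mutual information of a joint law on a product space: the KL divergence between
the joint law and the product of its marginals. -/
def mutualInfoJoint {β γ : Type*} [MeasurableSpace β] [MeasurableSpace γ]
    (π : Measure (β × γ)) : ℝ :=
  klDivR π ((π.map Prod.fst).prod (π.map Prod.snd))

/-- Joint law of `(X, H X + Z)` where `X ~ μ` and `Z ~ N(0, I_nr)` is independent of `X`. -/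
def jointLaw (H : Matrix (Fin nr) (Fin nt) ℝ) (μ : Measure (Fin nt → ℝ)) :
    Measure ((Fin nt → ℝ) × (Fin nr → ℝ)) :=
  (μ.prod (stdGaussian nr)).map (fun p => (p.1, H.mulVec p.1 + p.2))

/-- An admissible input distribution: a probability measure on `[0, A]^nt`
with average power `E[‖X‖₁] ≤ avg`. -/
def Admissible (nt : ℕ) (A avg : ℝ) (μ : Measure (Fin nt → ℝ)) : Prop :=
  IsProbabilityMeasure μ ∧ (∀ᵐ x ∂μ, ∀ k, x k ∈ Set.Icc (0 : ℝ) A) ∧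
    (∫ x, ∑ k, |x k| ∂μ) ≤ avg

/-- Capacity of the MIMO optical intensity channel with peak power `A` and
average power `avg`. -/
def capacity (H : Matrix (Fin nr) (Fin nt) ℝ) (A avg : ℝ) : ℝ :=
  sSup { c | ∃ μ : Measure (Fin nt → ℝ),
    Admissible nt A avg μ ∧ c = mutualInfoJoint (jointLaw H μ) }

/-- The zonotope `R(M) = { M λ : λ ∈ [0,A]^k }`. -/
def zonotope {n k : ℕ} (M : Matrix (Fin n) (Fin k) ℝ) (A : ℝ) : Set (Fin n → ℝ) :=
  { x | ∃ lam : Fin k → ℝ, (∀ i, lam i ∈ Set.Icc 0 A) ∧ x = M.mulVec lam }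

/-- The collection `𝒰` of `nr`-element subsets of columns that are linearly independent. -/
def goodSets (H : Matrix (Fin nr) (Fin nt) ℝ) : Set (Finset (Fin nt)) :=
  { U | U.card = nr ∧ LinearIndependent ℝ (fun j : {x // x ∈ U} => fun i => H i j.1) }

/-- The square matrix `H_U` whose columns are the columns of `H` indexed by `U`
(junk value, the identity, if `U.card ≠ nr`). -/
def HU (H : Matrix (Fin nr) (Fin nt) ℝ) (U : Finset (Fin nt)) :
    Matrix (Fin nr) (Fin nr) ℝ :=
  if h : U.card = nr then H.submatrix id (fun i => U.orderEmbOfFin h i) else 1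

/-- `a_{U,j} = 1ᵀ H_U⁻¹ h_j`. -/
def aUj (H : Matrix (Fin nr) (Fin nt) ℝ) (U : Finset (Fin nt)) (j : Fin nt) : ℝ :=
  ∑ i, ((HU H U)⁻¹).mulVec (fun r => H r j) i

/-- `g_{U,j} = 1` if `a_{U,j} > 1` and `0` otherwise. -/
def gUj (H : Matrix (Fin nr) (Fin nt) ℝ) (U : Finset (Fin nt)) (j : Fin nt) : ℝ :=
  if 1 < aUj H U j then 1 else 0

/-- `s_U = Σ_{j ∈ Uᶜ} g_{U,j}`. -/
def sU (H : Matrix (Fin nr) (Fin nt) ℝ) (U : Finset (Fin nt)) : ℝ :=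
  ∑ j ∈ Uᶜ, gUj H U j

/-- `v_U = A Σ_{j ∈ Uᶜ} g_{U,j} h_j`. -/
def vU (H : Matrix (Fin nr) (Fin nt) ℝ) (A : ℝ) (U : Finset (Fin nt)) : Fin nr → ℝ :=
  fun r => A * ∑ j ∈ Uᶜ, gUj H U j * H r j

/-- The parallelepiped `D_U = R(H_U)`. -/
def DU (H : Matrix (Fin nr) (Fin nt) ℝ) (A : ℝ) (U : Finset (Fin nt)) :
    Set (Fin nr → ℝ) :=
  zonotope (HU H U) A

/-- The shifted parallelepiped `v_U + D_U`. -/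
def cell (H : Matrix (Fin nr) (Fin nt) ℝ) (A : ℝ) (U : Finset (Fin nt)) :
    Set (Fin nr → ℝ) :=
  (fun d => vU H A U + d) '' DU H A U

/-- `V_H = Σ_{U ∈ 𝒰} |det H_U|`. -/
def VH (H : Matrix (Fin nr) (Fin nt) ℝ) : ℝ :=
  ∑ᶠ U ∈ goodSets H, |(HU H U).det|

/-- `q_U = |det H_U| / V_H`. -/
def qU (H : Matrix (Fin nr) (Fin nt) ℝ) (U : Finset (Fin nt)) : ℝ :=
  |(HU H U).det| / VH H

/-- `α_th = nr/2 + Σ_{U ∈ 𝒰} s_U q_U`. -/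
def alphaTh (H : Matrix (Fin nr) (Fin nt) ℝ) : ℝ :=
  (nr : ℝ) / 2 + ∑ᶠ U ∈ goodSets H, sU H U * qU H U

/-- A probability vector on `𝒰`. -/
def ProbVec (H : Matrix (Fin nr) (Fin nt) ℝ) (p : Finset (Fin nt) → ℝ) : Prop :=
  (∀ U, 0 ≤ p U) ∧ (∀ U, U ∉ goodSets H → p U = 0) ∧ (∑ᶠ U ∈ goodSets H, p U) = 1

/-- Kullback–Leibler divergence `D(p‖q)` between probability vectors on `𝒰`. -/
def Dkl (H : Matrix (Fin nr) (Fin nt) ℝ) (p q : Finset (Fin nt) → ℝ) : ℝ :=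
  ∑ᶠ U ∈ goodSets H, p U * Real.log (p U / q U)

/-- `σ_{U,ℓ}`: square root of the `ℓ`-th diagonal entry of `H_U⁻¹ (H_U⁻¹)ᵀ`. -/
def sigmaUl (H : Matrix (Fin nr) (Fin nt) ℝ) (U : Finset (Fin nt)) (ℓ : Fin nr) : ℝ :=
  Real.sqrt ((((HU H U)⁻¹) * ((HU H U)⁻¹)ᵀ) ℓ ℓ)

/-- The trace of the covariance matrix of `X̄ = H X` when `X ~ μ`. -/
def traceCov (H : Matrix (Fin nr) (Fin nt) ℝ) (μ : Measure (Fin nt → ℝ)) : ℝ :=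
  ∑ i, ((∫ x, (H.mulVec x i) ^ 2 ∂μ) - (∫ x, H.mulVec x i ∂μ) ^ 2)

/-- The Gaussian Q-function. -/
def Qf (x : ℝ) : ℝ :=
  ∫ t in Set.Ioi x, Real.exp (-t ^ 2 / 2) / Real.sqrt (2 * Real.pi)

/-- The high-SNR penalty `ν` due to the average-power constraint. -/
def nuVal (H : Matrix (Fin nr) (Fin nt) ℝ) (α : ℝ) : ℝ :=
  sSup { y | ∃ lam mu : ℝ,
    lam ∈ Set.Ioo (max 0 ((nr : ℝ) / 2 + α - alphaTh H)) (min ((nr : ℝ) / 2) α) ∧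
    0 < mu ∧
    1 / mu - Real.exp (-mu) / (1 - Real.exp (-mu)) = lam / (nr : ℝ) ∧
    y = (nr : ℝ) * (1 - Real.log (mu / (1 - Real.exp (-mu)))
          - mu * Real.exp (-mu) / (1 - Real.exp (-mu)))
        - sInf { d | ∃ p : Finset (Fin nt) → ℝ, ProbVec H p ∧
            (∑ᶠ U ∈ goodSets H, p U * sU H U) = α - lam ∧ d = Dkl H p (qU H) } }

end MimoOptical

namespace MimoOptical

/-- Likelihood ratio of `N(a, I)` with respect to `N(0, I)`. -/
def lr {n : ℕ} (a y : Fin n → ℝ) : ℝ := Real.exp (∑ i, (a i * y i - a i ^ 2 / 2))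

instance (n : ℕ) : IsProbabilityMeasure (stdGaussian n) := by
  unfold stdGaussian; infer_instance

lemma integral_exp_gaussian (t : ℝ) :
    ∫ x, Real.exp (t * x) ∂(gaussianReal 0 1) = Real.exp (t ^ 2 / 2) := by
  have h := congrFun (mgf_fun_id_gaussianReal (μ := 0) (v := 1)) t
  simpa [mgf] using h

lemma exp_sum_gaussian {n : ℕ} (b : Fin n → ℝ) :
    Integrable (fun z => Real.exp (∑ i, b i * z i)) (stdGaussian n) ∧
    ∫ z, Real.exp (∑ i, b i * z i) ∂(stdGaussian n) = Real.exp (∑ i, b i ^ 2 / 2) := by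
  simp_rw [Real.exp_sum]
  constructor
  · exact Integrable.fintype_prod (f := fun i x => Real.exp (b i * x))
      (fun i => integrable_exp_mul_gaussianReal (b i))
  · unfold stdGaussian
    rw [integral_fintype_prod_eq_prod (fun i x => Real.exp (b i * x))]
    simp_rw [integral_exp_gaussian]

lemma lintegral_exp_gaussian {n : ℕ} (b : Fin n → ℝ) (c : ℝ) :
    ∫⁻ z, ENNReal.ofReal (Real.exp (∑ i, b i * z i + c)) ∂(stdGaussian n)
      = ENNReal.ofReal (Real.exp (∑ i, b i ^ 2 / 2 + c)) := by
  obtain ⟨h1, h2⟩ := exp_sum_gaussian b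
  simp_rw [Real.exp_add]
  rw [← ofReal_integral_eq_lintegral_ofReal (h1.mul_const _)
    (ae_of_all _ fun x => by positivity), integral_mul_const, h2]

lemma integral_coord_gaussian {n : ℕ} (i : Fin n) :
    Integrable (fun z => z i) (stdGaussian n) ∧ ∫ z, z i ∂(stdGaussian n) = 0 := by
  constructor
  · exact integrable_eval (IsGaussian.integrable_id)
  · unfold stdGaussian
    rw [integral_eval]
    exact integral_id_gaussianReal

lemma gaussianReal_shift (a : ℝ) (s : Set ℝ) (hs : MeasurableSet s) :
    gaussianReal a 1 s = ENNReal.ofReal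
      (∫ y, s.indicator (fun y => Real.exp (a * y - a ^ 2 / 2)) y ∂(gaussianReal 0 1)) := by
  rw [gaussianReal_apply_eq_integral _ one_ne_zero, integral_gaussianReal_eq_integral_smul one_ne_zero,
    ← integral_indicator hs]
  congr 2
  ext y
  by_cases hy : y ∈ s
  · simp only [Set.indicator_of_mem hy, gaussianPDFReal_def, smul_eq_mul]
    rw [mul_assoc _ (Real.exp _) (Real.exp _), ← Real.exp_add]
    congr 2
    simp; ring
  · simp [hy]

lemma lr_eq {n : ℕ} (a y : Fin n → ℝ) :
    lr a y = Real.exp (∑ i, a i * y i + - ∑ i, a i ^ 2 / 2) := by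
  unfold lr; rw [Finset.sum_sub_distrib]; rfl

lemma lr_pos {n : ℕ} (a y : Fin n → ℝ) : 0 < lr a y := Real.exp_pos _

lemma lintegral_lr {n : ℕ} (a : Fin n → ℝ) :
    ∫⁻ z, ENNReal.ofReal (lr a z) ∂(stdGaussian n) = 1 := by
  simp_rw [lr_eq]
  rw [lintegral_exp_gaussian]
  simp

lemma measurable_lr {n : ℕ} : Measurable (fun p : (Fin n → ℝ) × (Fin n → ℝ) => lr p.1 p.2) := by
  unfold lr; fun_prop

lemma shift_gaussian {n : ℕ} (a : Fin n → ℝ) :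
    (stdGaussian n).map (fun z => a + z) =
      (stdGaussian n).withDensity (fun y => ENNReal.ofReal (lr a y)) := by
  have h1 : (stdGaussian n).map (fun z => a + z) = Measure.pi (fun i => gaussianReal (a i) 1) := by
    unfold stdGaussian
    have := Measure.pi_map_pi (μ := fun _ : Fin n => gaussianReal 0 1) (f := fun i x => a i + x)
      (fun i => by fun_prop)
    simp_rw [gaussianReal_map_const_add, zero_add] at this
    exact this
  rw [h1]
  refine Measure.pi_eq fun s hs => ?_
  have hm : Measurable (fun y => lr a y) := by unfold lr; fun_prop
  rw [withDensity_apply _ (MeasurableSet.univ_pi hs)]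
  simp_rw [gaussianReal_shift _ _ (hs _)]
  rw [← ENNReal.ofReal_prod_of_nonneg
    (fun i _ => integral_nonneg fun y => Set.indicator_nonneg (fun _ _ => (Real.exp_pos _).le) _),
    ← integral_fintype_prod_eq_prod
      (fun i y => (s i).indicator (fun y => Real.exp (a i * y - a i ^ 2 / 2)) y)]
  have hint : Integrable (fun y => lr a y) (stdGaussian n) := by
    refine ⟨hm.aestronglyMeasurable, ?_⟩
    rw [hasFiniteIntegral_iff_ofReal (ae_of_all _ fun y => (lr_pos a y).le), lintegral_lr]
    exact ENNReal.one_lt_top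
  rw [← ofReal_integral_eq_lintegral_ofReal hint.restrict (ae_of_all _ fun y => (lr_pos a y).le),
    ← integral_indicator (MeasurableSet.univ_pi hs)]
  unfold stdGaussian
  congr 2
  ext y
  by_cases hy : y ∈ Set.univ.pi s
  · rw [Set.indicator_of_mem hy]
    unfold lr
    rw [Real.exp_sum]
    refine Finset.prod_congr rfl fun i _ => ?_
    rw [Set.indicator_of_mem (hy i trivial)]
  · rw [Set.indicator_of_notMem hy]
    simp only [Set.mem_pi, not_forall] at hy
    obtain ⟨i, _, hi⟩ := hy
    exact (Finset.prod_eq_zero (Finset.mem_univ i) (Set.indicator_of_notMem hi _)).symm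

end MimoOptical
namespace MimoOptical

section Channel

variable {E : Type*} [MeasurableSpace E] {n : ℕ}

/-- Joint law of `(X, a(X) + Z)`. -/
def jl (μ : Measure E) (a : E → Fin n → ℝ) : Measure (E × (Fin n → ℝ)) :=
  (μ.prod (stdGaussian n)).map (fun p => (p.1, a p.1 + p.2))

/-- Output density with respect to the standard Gaussian. -/
def outD (μ : Measure E) (a : E → Fin n → ℝ) (y : Fin n → ℝ) : ℝ≥0∞ :=
  ∫⁻ x, ENNReal.ofReal (lr (a x) y) ∂μ

lemma meas_L {a : E → Fin n → ℝ} (ha : Measurable a) :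
    Measurable (fun p : E × (Fin n → ℝ) => ENNReal.ofReal (lr (a p.1) p.2)) := by
  unfold lr; fun_prop

lemma meas_out (μ : Measure E) [IsProbabilityMeasure μ] {a : E → Fin n → ℝ} (ha : Measurable a) :
    Measurable (outD μ a) := (meas_L ha).lintegral_prod_left'

lemma jl_eq (μ : Measure E) [IsProbabilityMeasure μ] {a : E → Fin n → ℝ} (ha : Measurable a) :
    jl μ a = (μ.prod (stdGaussian n)).withDensity
      (fun p => ENNReal.ofReal (lr (a p.1) p.2)) := by
  ext s hs
  have hf : Measurable (fun p : E × (Fin n → ℝ) => (p.1, a p.1 + p.2)) := by fun_prop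
  unfold jl
  rw [Measure.map_apply hf hs, Measure.prod_apply (hf hs), withDensity_apply _ hs,
    ← lintegral_indicator hs, lintegral_prod _ ((meas_L ha).indicator hs).aemeasurable]
  refine lintegral_congr fun x => ?_
  have hsx : MeasurableSet (Prod.mk x ⁻¹' s) := measurable_prodMk_left hs
  have h := congrArg (fun ν => ν (Prod.mk x ⁻¹' s)) (shift_gaussian (a x))
  rw [Measure.map_apply (by fun_prop) hsx, withDensity_apply _ hsx, ← lintegral_indicator hsx] at h
  exact h

lemma jl_prob (μ : Measure E) [IsProbabilityMeasure μ] {a : E → Fin n → ℝ}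
    (ha : Measurable a) : IsProbabilityMeasure (jl μ a) := by
  exact Measure.isProbabilityMeasure_map (by fun_prop)

lemma jl_fst (μ : Measure E) [IsProbabilityMeasure μ] {a : E → Fin n → ℝ} (ha : Measurable a) :
    (jl μ a).map Prod.fst = μ := by
  unfold jl
  rw [Measure.map_map (by fun_prop) (by fun_prop)]
  have := Measure.map_fst_prod (μ := μ) (ν := stdGaussian n)
  simp only [measure_univ, one_smul] at this
  exact this

lemma jl_snd (μ : Measure E) [IsProbabilityMeasure μ] {a : E → Fin n → ℝ} (ha : Measurable a) :
    (jl μ a).map Prod.snd = (stdGaussian n).withDensity (outD μ a) := by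
  ext s hs
  have hs' : MeasurableSet (Prod.snd ⁻¹' s : Set (E × (Fin n → ℝ))) := measurable_snd hs
  rw [Measure.map_apply measurable_snd hs, jl_eq μ ha, withDensity_apply _ hs',
    withDensity_apply _ hs, ← lintegral_indicator hs', ← lintegral_indicator hs,
    lintegral_prod_symm _ ((meas_L ha).indicator hs').aemeasurable]
  refine lintegral_congr fun y => ?_
  by_cases hy : y ∈ s
  · simp [Set.indicator, hy, outD]
  · simp [Set.indicator, hy]

lemma out_ne_zero (μ : Measure E) [IsProbabilityMeasure μ] {a : E → Fin n → ℝ}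
    (ha : Measurable a) (y : Fin n → ℝ) : outD μ a y ≠ 0 := by
  unfold outD
  have hm : Measurable fun x => ENNReal.ofReal (lr (a x) y) := by unfold lr; fun_prop
  rw [Ne, lintegral_eq_zero_iff hm]
  intro h
  have : ∀ᵐ x ∂μ, False := by
    filter_upwards [h] with x hx
    have := lr_pos (a x) y
    simp at hx
    linarith
  exact (IsProbabilityMeasure.ne_zero μ) (by simpa using this)

lemma lintegral_out (μ : Measure E) [IsProbabilityMeasure μ] {a : E → Fin n → ℝ}
    (ha : Measurable a) : ∫⁻ y, outD μ a y ∂(stdGaussian n) = 1 := by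
  unfold outD
  rw [lintegral_lintegral_swap]
  · simp_rw [lintegral_lr]; simp
  · have := (meas_L ha).comp (measurable_swap)
    exact this.aemeasurable

lemma out_lt_top (μ : Measure E) [IsProbabilityMeasure μ] {a : E → Fin n → ℝ}
    (ha : Measurable a) : ∀ᵐ y ∂(stdGaussian n), outD μ a y < ∞ :=
  ae_lt_top (meas_out μ ha) (by rw [lintegral_out μ ha]; simp)

lemma jl_ac (μ : Measure E) [IsProbabilityMeasure μ] {a : E → Fin n → ℝ} (ha : Measurable a) :
    jl μ a ≪ μ.prod (stdGaussian n) := by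
  rw [jl_eq μ ha]; exact withDensity_absolutelyContinuous _ _

lemma out_lt_top' (μ : Measure E) [IsProbabilityMeasure μ] {a : E → Fin n → ℝ}
    (ha : Measurable a) : ∀ᵐ p ∂(μ.prod (stdGaussian n)), outD μ a p.2 < ∞ :=
  Measure.quasiMeasurePreserving_snd.ae (out_lt_top μ ha)

lemma rn_aux {Ω : Type*} [MeasurableSpace Ω] (ν : Measure Ω) [IsProbabilityMeasure ν]
    (π : Measure Ω) [IsProbabilityMeasure π] (l f : Ω → ℝ≥0∞) (hl : Measurable l)
    (hf : Measurable f) (hπ : π = ν.withDensity l) (h0 : ∀ᵐ p ∂ν, f p ≠ 0)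
    (hi : ∀ᵐ p ∂ν, f p ≠ ∞) :
    ∀ᵐ p ∂π, (π.rnDeriv (ν.withDensity f) p).toReal = (l p).toReal / (f p).toReal := by
  have hac : π ≪ ν := by rw [hπ]; exact withDensity_absolutelyContinuous _ _
  have h1 := Measure.rnDeriv_withDensity_right π ν hf.aemeasurable h0 hi
  have h2 : π.rnDeriv ν =ᵐ[ν] l := by
    conv_lhs => rw [hπ]
    exact Measure.rnDeriv_withDensity _ hl
  have h1' := hac.ae_eq h1
  have h2' := hac.ae_eq h2
  filter_upwards [h1', h2'] with p hp1 hp2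
  rw [hp1, hp2, ENNReal.toReal_mul, ENNReal.toReal_inv,
    div_eq_mul_inv, mul_comm]

lemma jl_prod (μ : Measure E) [IsProbabilityMeasure μ] {a : E → Fin n → ℝ} (ha : Measurable a) :
    ((jl μ a).map Prod.fst).prod ((jl μ a).map Prod.snd) =
      (μ.prod (stdGaussian n)).withDensity (fun p => outD μ a p.2) := by
  have hfin : IsFiniteMeasure ((stdGaussian n).withDensity (outD μ a)) :=
    isFiniteMeasure_withDensity (by rw [lintegral_out μ ha]; simp)
  rw [jl_fst μ ha, jl_snd μ ha]
  exact prod_withDensity_right (meas_out μ ha)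

lemma jl_rn (μ : Measure E) [IsProbabilityMeasure μ] {a : E → Fin n → ℝ} (ha : Measurable a) :
    ∀ᵐ p ∂(jl μ a), ((jl μ a).rnDeriv (((jl μ a).map Prod.fst).prod ((jl μ a).map Prod.snd)) p).toReal
      = lr (a p.1) p.2 / (outD μ a p.2).toReal := by
  have hp := jl_prob μ ha
  have hmo : Measurable (fun p : E × (Fin n → ℝ) => outD μ a p.2) :=
    (meas_out μ ha).comp measurable_snd
  rw [jl_prod μ ha]
  have h := rn_aux (μ.prod (stdGaussian n)) (jl μ a) _ (fun p => outD μ a p.2) (meas_L ha) hmo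
    (jl_eq μ ha) (ae_of_all _ fun p => out_ne_zero μ ha p.2)
    ((out_lt_top' μ ha).mono fun p hp => hp.ne)
  filter_upwards [h] with p hp
  rw [hp, ENNReal.toReal_ofReal (lr_pos _ _).le]

end Channel

end MimoOptical
namespace MimoOptical

section Bounds

variable {E : Type*} [MeasurableSpace E] {n : ℕ}

/-- Mean of `a(X)`. -/
def mn (μ : Measure E) (a : E → Fin n → ℝ) : Fin n → ℝ := fun i => ∫ x, a x i ∂μ

/-- Trace of covariance of `a(X)`. -/
def tc (μ : Measure E) (a : E → Fin n → ℝ) : ℝ :=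
  ∑ i, ((∫ x, (a x i) ^ 2 ∂μ) - (∫ x, a x i ∂μ) ^ 2)

lemma int_coord (μ : Measure E) [IsProbabilityMeasure μ] {a : E → Fin n → ℝ} (ha : Measurable a)
    {B : ℝ} (hB : ∀ᵐ x ∂μ, ∀ i, |a x i| ≤ B) (i : Fin n) : Integrable (fun x => a x i) μ := by
  have hm : Measurable (fun x => a x i) := by fun_prop
  refine Integrable.of_bound hm.aestronglyMeasurable B ?_
  filter_upwards [hB] with x hx
  exact hx i

lemma int_coord_sq (μ : Measure E) [IsProbabilityMeasure μ] {a : E → Fin n → ℝ}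
    (ha : Measurable a)
    {B : ℝ} (hB : ∀ᵐ x ∂μ, ∀ i, |a x i| ≤ B) (i : Fin n) :
    Integrable (fun x => (a x i) ^ 2) μ := by
  have hm : Measurable (fun x => (a x i) ^ 2) := by fun_prop
  refine Integrable.of_bound hm.aestronglyMeasurable (B ^ 2) ?_
  filter_upwards [hB] with x hx
  rw [Real.norm_eq_abs, abs_pow]
  exact pow_le_pow_left₀ (abs_nonneg _) (hx i) 2

lemma mn_bound (μ : Measure E) [IsProbabilityMeasure μ] {a : E → Fin n → ℝ}
    {B : ℝ} (hB : ∀ᵐ x ∂μ, ∀ i, |a x i| ≤ B) (i : Fin n) : |mn μ a i| ≤ B := by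
  have := norm_integral_le_of_norm_le_const (μ := μ) (f := fun x => a x i) (C := B)
    (hB.mono fun x hx => hx i)
  simpa [mn] using this

/-- The log-likelihood ratio against the centred Gaussian. -/
def llr (μ : Measure E) (a : E → Fin n → ℝ) (p : E × (Fin n → ℝ)) : ℝ :=
  ∑ i, ((a p.1 i - mn μ a i) * p.2 i - (a p.1 i ^ 2 - mn μ a i ^ 2) / 2)

lemma llr_eq (μ : Measure E) (a : E → Fin n → ℝ) (p : E × (Fin n → ℝ)) :
    llr μ a p = Real.log (lr (a p.1) p.2) - Real.log (lr (mn μ a) p.2) := by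
  unfold llr lr
  rw [Real.log_exp, Real.log_exp, ← Finset.sum_sub_distrib]
  exact Finset.sum_congr rfl fun i _ => by ring

lemma llr_integral (μ : Measure E) [IsProbabilityMeasure μ] {a : E → Fin n → ℝ}
    (ha : Measurable a) {B : ℝ} (hB : ∀ᵐ x ∂μ, ∀ i, |a x i| ≤ B) :
    Integrable (llr μ a) (jl μ a) ∧ ∫ p, llr μ a p ∂(jl μ a) = tc μ a / 2 := by
  have hf : Measurable (fun p : E × (Fin n → ℝ) => (p.1, a p.1 + p.2)) := by fun_prop
  have hl : Measurable (llr μ a) := by unfold llr; fun_prop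
  have hE : ∀ p : E × (Fin n → ℝ), llr μ a (p.1, a p.1 + p.2) =
      ∑ i, ((a p.1 i ^ 2 / 2 - mn μ a i * a p.1 i + mn μ a i ^ 2 / 2)
        + (a p.1 i - mn μ a i) * p.2 i) := by
    intro p
    unfold llr
    refine Finset.sum_congr rfl fun i _ => ?_
    simp only [Pi.add_apply]
    ring
  have i1 : ∀ i, Integrable (fun x => a x i ^ 2 / 2 - mn μ a i * a x i + mn μ a i ^ 2 / 2) μ :=
    fun i => (((int_coord_sq μ ha hB i).div_const 2).sub
      ((int_coord μ ha hB i).const_mul _)).add (integrable_const _)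
  have i1' : ∀ i, Integrable (fun p : E × (Fin n → ℝ) =>
      a p.1 i ^ 2 / 2 - mn μ a i * a p.1 i + mn μ a i ^ 2 / 2) (μ.prod (stdGaussian n)) :=
    fun i => (i1 i).comp_fst (stdGaussian n)
  have i2 : ∀ i, Integrable (fun p : E × (Fin n → ℝ) => (a p.1 i - mn μ a i) * p.2 i)
      (μ.prod (stdGaussian n)) := fun i =>
    ((int_coord μ ha hB i).sub (integrable_const _)).mul_prod (integral_coord_gaussian i).1
  have i3 : ∀ i, Integrable (fun p : E × (Fin n → ℝ) =>
      a p.1 i ^ 2 / 2 - mn μ a i * a p.1 i + mn μ a i ^ 2 / 2 + (a p.1 i - mn μ a i) * p.2 i)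
      (μ.prod (stdGaussian n)) := fun i => (i1' i).add (i2 i)
  have i4 : ∀ i, Integrable (fun x => a x i ^ 2 / 2 - mn μ a i * a x i) μ :=
    fun i => ((int_coord_sq μ ha hB i).div_const 2).sub ((int_coord μ ha hB i).const_mul _)
  have hI : Integrable (fun p : E × (Fin n → ℝ) => llr μ a (p.1, a p.1 + p.2))
      (μ.prod (stdGaussian n)) := by
    simp_rw [hE]
    exact integrable_finsetSum _ fun i _ => i3 i
  constructor
  · unfold jl
    exact (integrable_map_measure hl.aestronglyMeasurable hf.aemeasurable).2 hI
  · unfold jl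
    rw [integral_map hf.aemeasurable hl.aestronglyMeasurable]
    simp_rw [hE]
    rw [integral_finsetSum _ fun i _ => i3 i]
    unfold tc
    rw [Finset.sum_div]
    refine Finset.sum_congr rfl fun i _ => ?_
    rw [integral_add (i1' i) (i2 i),
      integral_prod_mul (fun x => a x i - mn μ a i) (fun z : Fin n → ℝ => z i),
      (integral_coord_gaussian i).2,
      integral_fun_fst (fun x => a x i ^ 2 / 2 - mn μ a i * a x i + mn μ a i ^ 2 / 2),
      integral_add (i4 i) (integrable_const _),
      integral_sub ((int_coord_sq μ ha hB i).div_const 2)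
      ((int_coord μ ha hB i).const_mul _), integral_const_mul, integral_div]
    simp [mn]
    ring

lemma ratio_eq (μ : Measure E) {a : E → Fin n → ℝ}
    (ha : Measurable a) (m v z : Fin n → ℝ) :
    outD μ a (v + z) / ENNReal.ofReal (lr m (v + z)) =
      ∫⁻ x', ENNReal.ofReal (Real.exp (∑ i, (a x' i - m i) * z i +
        ∑ i, ((a x' i - m i) * v i - (a x' i ^ 2 - m i ^ 2) / 2))) ∂μ := by
  have hm : Measurable fun x' => ENNReal.ofReal (lr (a x') (v + z)) := by unfold lr; fun_prop
  unfold outD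
  rw [div_eq_mul_inv, ← lintegral_mul_const _ hm]
  refine lintegral_congr fun x' => ?_
  rw [← div_eq_mul_inv, ← ENNReal.ofReal_div_of_pos (lr_pos _ _)]
  unfold lr
  rw [← Real.exp_sub, ← Finset.sum_sub_distrib, ← Finset.sum_add_distrib]
  congr 2
  refine Finset.sum_congr rfl fun i _ => ?_
  simp only [Pi.add_apply]
  ring

lemma ratio_inner (μ : Measure E) [IsProbabilityMeasure μ] {a : E → Fin n → ℝ}
    (ha : Measurable a) (m v : Fin n → ℝ) :
    ∫⁻ z, outD μ a (v + z) / ENNReal.ofReal (lr m (v + z)) ∂(stdGaussian n) =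
      ∫⁻ x', ENNReal.ofReal (Real.exp (∑ i, (v i - m i) * (a x' i - m i))) ∂μ := by
  simp_rw [ratio_eq μ ha m v]
  have hmeas : Measurable (fun q : (Fin n → ℝ) × E =>
      ENNReal.ofReal (Real.exp (∑ i, (a q.2 i - m i) * q.1 i +
        ∑ i, ((a q.2 i - m i) * v i - (a q.2 i ^ 2 - m i ^ 2) / 2)))) := by fun_prop
  rw [lintegral_lintegral_swap hmeas.aemeasurable]
  refine lintegral_congr fun x' => ?_
  rw [lintegral_exp_gaussian, ← Finset.sum_add_distrib]
  congr 2
  refine Finset.sum_congr rfl fun i _ => ?_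
  ring

lemma lintegral_ratio (μ : Measure E) [IsProbabilityMeasure μ] {a : E → Fin n → ℝ}
    (ha : Measurable a) (m : Fin n → ℝ) :
    ∫⁻ p, outD μ a p.2 / ENNReal.ofReal (lr m p.2) ∂(jl μ a) =
      ∫⁻ x, ∫⁻ x', ENNReal.ofReal (Real.exp (∑ i, (a x i - m i) * (a x' i - m i))) ∂μ ∂μ := by
  have hf : Measurable (fun p : E × (Fin n → ℝ) => (p.1, a p.1 + p.2)) := by fun_prop
  have hf2 : Measurable (fun p : E × (Fin n → ℝ) => a p.1 + p.2) := by fun_prop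
  have hlm : Measurable (fun y => ENNReal.ofReal (lr m y)) := by unfold lr; fun_prop
  have hr : Measurable (fun y => outD μ a y / ENNReal.ofReal (lr m y)) := (meas_out μ ha).div hlm
  have hg : Measurable (fun p : E × (Fin n → ℝ) => outD μ a p.2 / ENNReal.ofReal (lr m p.2)) :=
    hr.comp measurable_snd
  have hgf : Measurable (fun p : E × (Fin n → ℝ) =>
      outD μ a (a p.1 + p.2) / ENNReal.ofReal (lr m (a p.1 + p.2))) := hr.comp hf2
  unfold jl
  rw [lintegral_map hg hf]
  dsimp only
  rw [lintegral_prod _ hgf.aemeasurable]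
  exact lintegral_congr fun x => ratio_inner μ ha m (a x)

lemma lintegral_ratio_inv (μ : Measure E) [IsProbabilityMeasure μ] {a : E → Fin n → ℝ}
    (ha : Measurable a) (m : Fin n → ℝ) :
    ∫⁻ p, ENNReal.ofReal (lr m p.2) / outD μ a p.2 ∂(jl μ a) ≤ 1 := by
  have hlm : Measurable (fun y => ENNReal.ofReal (lr m y)) := by unfold lr; fun_prop
  have hg : Measurable (fun y => ENNReal.ofReal (lr m y) / outD μ a y) :=
    hlm.div (meas_out μ ha)
  have h := lintegral_map (μ := jl μ a) hg measurable_snd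
  rw [← h, jl_snd μ ha, lintegral_withDensity_eq_lintegral_mul _ (meas_out μ ha) hg,
    ← lintegral_lr m]
  refine lintegral_mono fun y => ?_
  exact ENNReal.mul_div_le

lemma exp_quad {t e : ℝ} (h : |t| ≤ e) (he : e ≤ 1) : Real.exp t ≤ 1 + e ^ 2 + t := by
  have h1 := Real.abs_exp_sub_one_sub_id_le (h.trans he)
  have h2 := (abs_le.1 h1).2
  have h3 : t ^ 2 ≤ e ^ 2 := sq_le_sq' (abs_le.1 h).1 (abs_le.1 h).2
  linarith

lemma lintegral_ratio_le (μ : Measure E) [IsProbabilityMeasure μ] {a : E → Fin n → ℝ}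
    (ha : Measurable a) {B : ℝ} (hB : ∀ᵐ x ∂μ, ∀ i, |a x i| ≤ B) (hsm : n * (2 * B) ^ 2 ≤ 1) :
    ∫⁻ p, outD μ a p.2 / ENNReal.ofReal (lr (mn μ a) p.2) ∂(jl μ a) ≤
      ENNReal.ofReal (1 + (n * (2 * B) ^ 2) ^ 2) := by
  rw [lintegral_ratio μ ha]
  set e := n * (2 * B) ^ 2
  have hd : ∀ᵐ x ∂μ, ∀ i, |a x i - mn μ a i| ≤ 2 * B := by
    filter_upwards [hB] with x hx i
    have := abs_sub (a x i) (mn μ a i)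
    have := mn_bound μ hB i
    have := hx i
    linarith
  have hc : ∀ᵐ x ∂μ, ∀ᵐ x' ∂μ, |∑ i, (a x i - mn μ a i) * (a x' i - mn μ a i)| ≤ e := by
    filter_upwards [hd] with x hx
    filter_upwards [hd] with x' hx'
    refine (Finset.abs_sum_le_sum_abs _ _).trans ?_
    have : ∀ i ∈ Finset.univ, |(a x i - mn μ a i) * (a x' i - mn μ a i)| ≤ (2 * B) ^ 2 := by
      intro i _
      rw [abs_mul, sq]
      exact mul_le_mul (hx i) (hx' i) (abs_nonneg _) ((abs_nonneg _).trans (hx i))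
    refine (Finset.sum_le_sum this).trans ?_
    simp [e]
  have hin : ∀ᵐ x ∂μ, ∫⁻ x', ENNReal.ofReal
      (Real.exp (∑ i, (a x i - mn μ a i) * (a x' i - mn μ a i))) ∂μ
        ≤ ENNReal.ofReal (1 + e ^ 2) := by
    filter_upwards [hc] with x hx
    have hterm : ∀ i, Integrable (fun x' => (a x i - mn μ a i) * (a x' i - mn μ a i)) μ :=
      fun i => ((int_coord μ ha hB i).sub (integrable_const _)).const_mul _
    have hsum : Integrable (fun x' => ∑ i, (a x i - mn μ a i) * (a x' i - mn μ a i)) μ :=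
      integrable_finsetSum _ fun i _ => hterm i
    have hz : ∫ x', ∑ i, (a x i - mn μ a i) * (a x' i - mn μ a i) ∂μ = 0 := by
      rw [integral_finsetSum _ fun i _ => hterm i]
      refine Finset.sum_eq_zero fun i _ => ?_
      rw [integral_const_mul, integral_sub (int_coord μ ha hB i) (integrable_const _)]
      simp [mn]
    calc _ ≤ ∫⁻ x', ENNReal.ofReal
          (1 + e ^ 2 + ∑ i, (a x i - mn μ a i) * (a x' i - mn μ a i)) ∂μ := by
          refine lintegral_mono_ae ?_
          filter_upwards [hx] with x' hx'
          exact ENNReal.ofReal_le_ofReal (exp_quad hx' hsm)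
      _ = ENNReal.ofReal (1 + e ^ 2) := by
          have hs2 : Integrable (fun x' => 1 + e ^ 2 +
              ∑ i, (a x i - mn μ a i) * (a x' i - mn μ a i)) μ := (integrable_const _).add hsum
          rw [← ofReal_integral_eq_lintegral_ofReal hs2,
            integral_add (integrable_const _) hsum, hz]
          · simp
          · filter_upwards [hx] with x' hx'
            exact (Real.exp_pos _).le.trans (exp_quad hx' hsm)
  refine (lintegral_mono_ae hin).trans ?_
  simp

lemma integral_le_of_lintegral_le {Ω : Type*} [MeasurableSpace Ω] (P : Measure Ω)
    {f : Ω → ℝ} (hf : Measurable f) (h0 : ∀ x, 0 ≤ f x) {c : ℝ} (hc : 0 ≤ c)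
    (h : ∫⁻ x, ENNReal.ofReal (f x) ∂P ≤ ENNReal.ofReal c) :
    Integrable f P ∧ ∫ x, f x ∂P ≤ c := by
  constructor
  · refine ⟨hf.aestronglyMeasurable, ?_⟩
    rw [hasFiniteIntegral_iff_ofReal (ae_of_all _ h0)]
    exact h.trans_lt ENNReal.ofReal_lt_top
  · rw [integral_eq_lintegral_of_nonneg_ae (ae_of_all _ h0) hf.aestronglyMeasurable]
    exact ENNReal.toReal_le_of_le_ofReal hc h

theorem mi_bounds (μ : Measure E) [IsProbabilityMeasure μ] {a : E → Fin n → ℝ}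
    (ha : Measurable a) {B : ℝ} (hB : ∀ᵐ x ∂μ, ∀ i, |a x i| ≤ B) (hsm : n * (2 * B) ^ 2 ≤ 1) :
    tc μ a / 2 - (n * (2 * B) ^ 2) ^ 2 ≤ mutualInfoJoint (jl μ a) ∧
      mutualInfoJoint (jl μ a) ≤ tc μ a / 2 := by
  have hP := jl_prob μ ha
  set m := mn μ a with hm
  let G : E × (Fin n → ℝ) → ℝ := fun p => (outD μ a p.2).toReal / lr m p.2
  have hlm : Measurable (fun y => lr m y) := by unfold lr; fun_prop
  have hG : Measurable G :=
    ((meas_out μ ha).comp measurable_snd).ennreal_toReal.div (hlm.comp measurable_snd)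
  have hfin : ∀ᵐ p ∂(jl μ a), outD μ a p.2 < ∞ := (jl_ac μ ha).ae_le (out_lt_top' μ ha)
  have hpos : ∀ᵐ p ∂(jl μ a), 0 < (outD μ a p.2).toReal := by
    filter_upwards [hfin] with p hp
    exact ENNReal.toReal_pos (out_ne_zero μ ha _) hp.ne
  obtain ⟨iG, bG⟩ := integral_le_of_lintegral_le (jl μ a) hG
    (fun p => div_nonneg ENNReal.toReal_nonneg (lr_pos _ _).le)
    (c := 1 + (n * (2 * B) ^ 2) ^ 2) (by positivity) (by
      refine le_trans (lintegral_mono fun p => ?_) (lintegral_ratio_le μ ha hB hsm)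
      simp only [G]
      rw [ENNReal.ofReal_div_of_pos (lr_pos _ _)]
      gcongr
      exact ENNReal.ofReal_toReal_le)
  obtain ⟨iG', bG'⟩ := integral_le_of_lintegral_le (jl μ a) hG.inv
    (fun p => inv_nonneg.2 (div_nonneg ENNReal.toReal_nonneg (lr_pos _ _).le))
    (c := 1) (by positivity) (by
      rw [ENNReal.ofReal_one]
      refine le_trans (lintegral_mono_ae ?_) (lintegral_ratio_inv μ ha m)
      filter_upwards [hfin, hpos] with p hp hp'
      simp only [G, Pi.inv_apply]
      rw [inv_div, ENNReal.ofReal_div_of_pos hp', ENNReal.ofReal_toReal hp.ne])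
  have hle : ∀ᵐ p ∂(jl μ a), Real.log (G p) ≤ G p - 1 := by
    filter_upwards [hpos] with p hp
    exact Real.log_le_sub_one_of_pos (div_pos hp (lr_pos _ _))
  have hge : ∀ᵐ p ∂(jl μ a), -Real.log (G p) ≤ (G p)⁻¹ - 1 := by
    filter_upwards [hpos] with p hp
    rw [← Real.log_inv]
    exact Real.log_le_sub_one_of_pos (inv_pos.2 (div_pos hp (lr_pos _ _)))
  have ilog : Integrable (fun p => Real.log (G p)) (jl μ a) := by
    refine Integrable.mono' (iG.add iG') hG.log.aestronglyMeasurable ?_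
    filter_upwards [hle, hge, hpos] with p h1 h2 h3
    have : 0 < G p := div_pos h3 (lr_pos _ _)
    have : 0 < (G p)⁻¹ := inv_pos.2 this
    simp only [Pi.add_apply, Pi.inv_apply]
    rw [Real.norm_eq_abs, abs_le]
    constructor <;> linarith
  have b1 : ∫ p, Real.log (G p) ∂(jl μ a) ≤ (n * (2 * B) ^ 2) ^ 2 := by
    have i1 : Integrable (fun p => G p - 1) (jl μ a) := iG.sub (integrable_const 1)
    have := integral_mono_ae ilog i1 hle
    have h2 : ∫ p, (G p - 1) ∂(jl μ a) = ∫ p, G p ∂(jl μ a) - 1 := by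
      rw [integral_sub iG (integrable_const 1)]; simp
    linarith
  have b2 : -∫ p, Real.log (G p) ∂(jl μ a) ≤ 0 := by
    have i0 : Integrable (fun p => (G p)⁻¹) (jl μ a) := iG'
    have i1 : Integrable (fun p => (G p)⁻¹ - 1) (jl μ a) := i0.sub (integrable_const 1)
    have i2 : Integrable (fun p => -Real.log (G p)) (jl μ a) := ilog.neg
    have := integral_mono_ae i2 i1 hge
    have h2 : ∫ p, ((G p)⁻¹ - 1) ∂(jl μ a) = ∫ p, (G p)⁻¹ ∂(jl μ a) - 1 := by
      rw [integral_sub i0 (integrable_const 1)]; simp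
    rw [integral_neg] at this
    have h4 : ∫ p, (G p)⁻¹ ∂(jl μ a) ≤ 1 := bG'
    linarith
  have key : mutualInfoJoint (jl μ a) = tc μ a / 2 - ∫ p, Real.log (G p) ∂(jl μ a) := by
    obtain ⟨il, vl⟩ := llr_integral μ ha hB
    rw [← vl, ← integral_sub il ilog]
    unfold mutualInfoJoint klDivR
    refine integral_congr_ae ?_
    filter_upwards [jl_rn μ ha, hpos] with p hp hp'
    rw [hp, llr_eq]
    simp only [G]
    rw [Real.log_div (lr_pos _ _).ne' hp'.ne', Real.log_div hp'.ne' (lr_pos _ _).ne']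
    ring
  rw [key]
  constructor <;> linarith

end Bounds

end MimoOptical
namespace MimoOptical

section Final

variable {nt nr : ℕ}

/-- A bound for the entries of `H x`, `x ∈ [0,1]^nt`. -/
def cH (H : Matrix (Fin nr) (Fin nt) ℝ) : ℝ := ∑ i, ∑ j, |H i j|

lemma cH_nonneg (H : Matrix (Fin nr) (Fin nt) ℝ) : 0 ≤ cH H := by
  unfold cH; positivity

lemma mulVec_bound (H : Matrix (Fin nr) (Fin nt) ℝ) {A : ℝ} {x : Fin nt → ℝ}
    (hx : ∀ k, x k ∈ Set.Icc (0 : ℝ) A) (i : Fin nr) : |H.mulVec x i| ≤ A * cH H := by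
  have h1 : |H.mulVec x i| ≤ ∑ j, |H i j| * A := by
    simp only [Matrix.mulVec, dotProduct]
    refine (Finset.abs_sum_le_sum_abs _ _).trans (Finset.sum_le_sum fun j _ => ?_)
    rw [abs_mul, abs_of_nonneg (hx j).1]
    exact mul_le_mul_of_nonneg_left (hx j).2 (abs_nonneg _)
  rw [← Finset.sum_mul] at h1
  have h2 : ∑ j, |H i j| ≤ cH H :=
    Finset.single_le_sum (f := fun i => ∑ j, |H i j|)
      (fun i _ => Finset.sum_nonneg fun j _ => abs_nonneg _) (Finset.mem_univ i)
  rcases isEmpty_or_nonempty (Fin nt) with he | ⟨⟨j⟩⟩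
  · simp [Matrix.mulVec, dotProduct, cH]
  · have hA : 0 ≤ A := (hx j).1.trans (hx j).2
    nlinarith

lemma meas_mulVec (H : Matrix (Fin nr) (Fin nt) ℝ) : Measurable (fun x => H.mulVec x) :=
  (Continuous.matrix_mulVec continuous_const continuous_id).measurable

lemma adm_scale (H : Matrix (Fin nr) (Fin nt) ℝ) {A r s : ℝ} (hs : 0 < s)
    {μ : Measure (Fin nt → ℝ)} (hμ : Admissible nt A r μ) :
    Admissible nt (s * A) (s * r) (μ.map (fun x => s • x)) ∧
      traceCov H (μ.map (fun x => s • x)) = s ^ 2 * traceCov H μ := by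
  obtain ⟨h1, h2, h3⟩ := hμ
  have hm : Measurable (fun x : Fin nt → ℝ => s • x) := by fun_prop
  refine ⟨⟨Measure.isProbabilityMeasure_map hm.aemeasurable, ?_, ?_⟩, ?_⟩
  · have hset : MeasurableSet {x : Fin nt → ℝ | ∀ k, x k ∈ Set.Icc (0 : ℝ) (s * A)} := by
      have : {x : Fin nt → ℝ | ∀ k, x k ∈ Set.Icc (0 : ℝ) (s * A)} =
          Set.univ.pi fun _ => Set.Icc (0 : ℝ) (s * A) := by
        ext; simp only [Set.mem_ofPred_eq, Set.mem_pi, Set.mem_univ, true_implies]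
      rw [this]
      exact MeasurableSet.univ_pi fun _ => measurableSet_Icc
    rw [ae_map_iff hm.aemeasurable hset]
    filter_upwards [h2] with x hx k
    simp only [Pi.smul_apply, smul_eq_mul]
    exact ⟨mul_nonneg hs.le (hx k).1, mul_le_mul_of_nonneg_left (hx k).2 hs.le⟩
  · have hm2 : Measurable (fun x : Fin nt → ℝ => ∑ k, |x k|) :=
      Continuous.measurable (by fun_prop)
    rw [integral_map hm.aemeasurable hm2.aestronglyMeasurable]
    simp only [Pi.smul_apply, smul_eq_mul, abs_mul, abs_of_pos hs, ← Finset.mul_sum]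
    rw [integral_const_mul]
    exact mul_le_mul_of_nonneg_left h3 hs.le
  · unfold traceCov
    rw [Finset.mul_sum]
    refine Finset.sum_congr rfl fun i _ => ?_
    have hi : Measurable (fun x => H.mulVec x i) := (measurable_pi_apply i).comp (meas_mulVec H)
    rw [integral_map hm.aemeasurable (hi.pow_const 2).aestronglyMeasurable,
      integral_map hm.aemeasurable hi.aestronglyMeasurable]
    simp only [Matrix.mulVec_smul, Pi.smul_apply, smul_eq_mul, mul_pow]
    rw [integral_const_mul, integral_const_mul]
    ring

lemma mi_adm (H : Matrix (Fin nr) (Fin nt) ℝ) {A r : ℝ}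
    (hsm : nr * (2 * (A * cH H)) ^ 2 ≤ 1) {μ : Measure (Fin nt → ℝ)} (hμ : Admissible nt A r μ) :
    traceCov H μ / 2 - (nr * (2 * (A * cH H)) ^ 2) ^ 2 ≤ mutualInfoJoint (jointLaw H μ) ∧
      mutualInfoJoint (jointLaw H μ) ≤ traceCov H μ / 2 := by
  obtain ⟨h1, h2, h3⟩ := hμ
  exact mi_bounds μ (a := fun x => H.mulVec x) (meas_mulVec H)
    (h2.mono fun x hx i => mulVec_bound H hx i) hsm

lemma tc_le (H : Matrix (Fin nr) (Fin nt) ℝ) {r : ℝ} {μ : Measure (Fin nt → ℝ)}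
    (hμ : Admissible nt 1 r μ) : traceCov H μ ≤ nr * cH H ^ 2 := by
  obtain ⟨h1, h2, h3⟩ := hμ
  have hB : ∀ᵐ x ∂μ, ∀ i, |H.mulVec x i| ≤ cH H :=
    h2.mono fun x hx i => by simpa using mulVec_bound H hx i
  have h : ∀ i ∈ Finset.univ, (∫ x, (H.mulVec x i) ^ 2 ∂μ) - (∫ x, H.mulVec x i ∂μ) ^ 2
      ≤ cH H ^ 2 := by
    intro i _
    have h4 : ∫ x, (H.mulVec x i) ^ 2 ∂μ ≤ ∫ _, cH H ^ 2 ∂μ := by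
      refine integral_mono_ae (int_coord_sq μ (meas_mulVec H) hB i) (integrable_const _) ?_
      filter_upwards [hB] with x hx
      exact sq_le_sq' (abs_le.1 (hx i)).1 (abs_le.1 (hx i)).2
    simp only [integral_const, probReal_univ, one_smul] at h4
    nlinarith [sq_nonneg (∫ x, H.mulVec x i ∂μ)]
  refine (Finset.sum_le_sum h).trans ?_
  simp

lemma adm_dirac {A r : ℝ} (hA : 0 ≤ A) (hr : 0 ≤ r) :
    Admissible nt A r (Measure.dirac 0) := by
  refine ⟨inferInstance, ?_, ?_⟩
  · rw [ae_dirac_eq]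
    simpa using fun _ => hA
  · simpa using hr

/-- The set of attainable covariance traces. -/
def tSet (H : Matrix (Fin nr) (Fin nt) ℝ) (α : ℝ) : Set ℝ :=
  { t | ∃ μ : Measure (Fin nt → ℝ), Admissible nt 1 α μ ∧ t = traceCov H μ }

lemma capacity_bounds (H : Matrix (Fin nr) (Fin nt) ℝ) {α A : ℝ} (hα : 0 < α) (hA : 0 < A)
    (hsm : nr * (2 * (A * cH H)) ^ 2 ≤ 1) :
    A ^ 2 * (sSup (tSet H α) / 2) - (nr * (2 * (A * cH H)) ^ 2) ^ 2 ≤ capacity H A (α * A) ∧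
    capacity H A (α * A) ≤ A ^ 2 * (sSup (tSet H α) / 2) := by
  have hbdd : BddAbove (tSet H α) := by
    refine ⟨nr * cH H ^ 2, ?_⟩
    rintro t ⟨μ, hμ, rfl⟩
    exact tc_le H hμ
  have hne : (tSet H α).Nonempty := ⟨_, _, adm_dirac zero_le_one hα.le, rfl⟩
  have hup : ∀ μ : Measure (Fin nt → ℝ), Admissible nt A (α * A) μ →
      mutualInfoJoint (jointLaw H μ) ≤ A ^ 2 * (sSup (tSet H α) / 2) := by
    intro μ hμ
    have h1 := (mi_adm H hsm hμ).2
    obtain ⟨h2, h3⟩ := adm_scale H (inv_pos.2 hA) hμ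
    have e1 : A⁻¹ * A = 1 := inv_mul_cancel₀ hA.ne'
    have e2 : A⁻¹ * (α * A) = α := by field_simp
    rw [e1, e2] at h2
    have h4 : A⁻¹ ^ 2 * traceCov H μ ≤ sSup (tSet H α) := le_csSup hbdd ⟨_, h2, h3.symm⟩
    have h5 : traceCov H μ = A ^ 2 * (A⁻¹ ^ 2 * traceCov H μ) := by field_simp
    have h6 := mul_le_mul_of_nonneg_left h4 (sq_nonneg A)
    linarith
  constructor
  · have : sSup (tSet H α) ≤
        2 * (capacity H A (α * A) + (nr * (2 * (A * cH H)) ^ 2) ^ 2) / A ^ 2 := by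
      refine csSup_le hne ?_
      rintro t ⟨μ, hμ, rfl⟩
      obtain ⟨h2, h3⟩ := adm_scale H hA hμ
      rw [mul_one, mul_comm A α] at h2
      have h1 := (mi_adm H hsm h2).1
      have h4 : mutualInfoJoint (jointLaw H (μ.map (fun x => A • x))) ≤ capacity H A (α * A) := by
        refine le_csSup ⟨A ^ 2 * (sSup (tSet H α) / 2), ?_⟩ ⟨_, h2, rfl⟩
        rintro c ⟨ν, hν, rfl⟩
        exact hup ν hν
      rw [le_div_iff₀ (by positivity)]
      rw [h3] at h1
      linarith
    rw [le_div_iff₀ (by positivity)] at this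
    linarith
  · refine csSup_le ⟨_, _, adm_dirac hA.le (by positivity), rfl⟩ ?_
    rintro c ⟨μ, hμ, rfl⟩
    exact hup μ hμ

end Final

end MimoOptical

/-- Low-SNR asymptotics: for arbitrary `α > 0`,
`lim_{A↓0} C_H(A, αA)/A² = (1/2) max_{P_X} tr(Cov(HX))`, the maximum being over all
distributions on `[0,1]^nt` with `E[‖X‖₁] ≤ α`. -/
theorem MimoOptical.low_snr_asymptotics
    (nt nr : ℕ) (hnr : 1 ≤ nr) (hntnr : nr < nt)
    (H : Matrix (Fin nr) (Fin nt) ℝ) (hrank : H.rank = nr)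
    (α : ℝ) (hα : 0 < α) :
    Filter.Tendsto (fun A : ℝ => MimoOptical.capacity H A (α * A) / A ^ 2)
      (nhdsWithin 0 (Set.Ioi 0))
      (nhds ((1 / 2) *
        sSup { t | ∃ μ : Measure (Fin nt → ℝ), IsProbabilityMeasure μ ∧
          (∀ᵐ x ∂μ, ∀ k, x k ∈ Set.Icc (0 : ℝ) 1) ∧
          (∫ x, ∑ k, |x k| ∂μ) ≤ α ∧ t = MimoOptical.traceCov H μ })) := by

  open MimoOptical in
  have hset : { t | ∃ μ : Measure (Fin nt → ℝ), IsProbabilityMeasure μ ∧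
          (∀ᵐ x ∂μ, ∀ k, x k ∈ Set.Icc (0 : ℝ) 1) ∧
          (∫ x, ∑ k, |x k| ∂μ) ≤ α ∧ t = MimoOptical.traceCov H μ } = tSet H α := by
    ext t
    simp only [tSet, Admissible, Set.mem_ofPred_eq, and_assoc]
  rw [hset]
  set S := sSup (MimoOptical.tSet H α)
  set K : ℝ := nr * (2 * MimoOptical.cH H) ^ 2 with hK
  have hKA : ∀ A : ℝ, nr * (2 * (A * MimoOptical.cH H)) ^ 2 = K * A ^ 2 := by
    intro A; rw [hK]; ring
  have hcont : Filter.Tendsto (fun A : ℝ => K * A ^ 2) (nhdsWithin 0 (Set.Ioi 0)) (nhds 0) := by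
    have : Continuous fun A : ℝ => K * A ^ 2 := by fun_prop
    have h := this.tendsto 0
    simp only [ne_eq, OfNat.ofNat_ne_zero, not_false_eq_true, zero_pow, mul_zero] at h
    exact h.mono_left nhdsWithin_le_nhds
  have hev : ∀ᶠ A in nhdsWithin (0 : ℝ) (Set.Ioi 0), 0 < A ∧ K * A ^ 2 ≤ 1 := by
    filter_upwards [self_mem_nhdsWithin, hcont.eventually (ge_mem_nhds zero_lt_one)] with A h1 h2
    exact ⟨h1, h2⟩
  have hlow : Filter.Tendsto (fun A : ℝ => (1 / 2) * S - K * (K * A ^ 2))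
      (nhdsWithin 0 (Set.Ioi 0)) (nhds ((1 / 2) * S)) := by
    have := (tendsto_const_nhds (x := (1 / 2) * S)).sub (hcont.const_mul K)
    simpa using this
  refine tendsto_of_tendsto_of_tendsto_of_le_of_le' hlow tendsto_const_nhds ?_ ?_
  · filter_upwards [hev] with A hA
    have h := (MimoOptical.capacity_bounds H hα hA.1 (by rw [hKA]; exact hA.2)).1
    rw [hKA] at h
    have hA2 : 0 < A ^ 2 := pow_pos hA.1 2
    rw [le_div_iff₀ hA2]
    refine le_trans (le_of_eq ?_) h
    ring
  · filter_upwards [hev] with A hA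
    have h := (MimoOptical.capacity_bounds H hα hA.1 (by rw [hKA]; exact hA.2)).2
    have hA2 : 0 < A ^ 2 := pow_pos hA.1 2
    rw [div_le_iff₀ hA2]
    refine le_trans h (le_of_eq ?_)
    ring
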